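/- arXiv:1501.02708 — 2 statements merged into one kernel-verified Lean document; each statement's English description precedes it below -/
import Mathlib

section
/- Every permutation π of the set Fin d_A × Fin d_B can be written as π = π_1 ∘ π_2 ∘ π_3, where π_1 and π_3 preserve the first coordinate (i.e., there are families f, h : Fin d_A → Perm(Fin d_B) with π_1(a,b) = (a, f(a)(b)) and π_3(a,b) = (a, h(a)(b))) and π_2 preserves the second coordinate (i.e., there is a family g : Fin d_B → Perm(Fin d_A) with π_2(a,b) = (g(b)(a), b)). -/
/-- A regular bipartite multigraph of positive degree, with edge set `S` and endpoint maps
`s` and `t`, has a perfect matching. -/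
theorem exists_perfect_matching_of_regular {E A : Type*} [DecidableEq A] [Finite A]
    (s t : E → A) (S : Finset E) {n : ℕ} (hn : 0 < n)
    (hs : ∀ a, (S.filter (s · = a)).card = n) (ht : ∀ a, (S.filter (t · = a)).card = n) :
    ∃ m : A → E, (∀ a, m a ∈ S) ∧ (∀ a, s (m a) = a) ∧ Function.Bijective (t ∘ m) := by
  classical
  have hall : ∀ X : Finset A,
      X.card ≤ (X.biUnion fun a => (S.filter (s · = a)).image t).card := by
    intro X
    set N := X.biUnion fun a => (S.filter (s · = a)).image t with hN
    have h₁ : (S.filter (s · ∈ X)).card = X.card * n := by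
      rw [Finset.card_eq_sum_card_fiberwise (f := s) (t := X) (by intro e; simp),
        ← smul_eq_mul, ← Finset.sum_const]
      refine Finset.sum_congr rfl fun a ha => ?_
      rw [← hs a, Finset.filter_filter]
      congr 1
      ext e
      simp only [Finset.mem_filter]
      grind
    have h₂ : (S.filter (t · ∈ N)).card = N.card * n := by
      rw [Finset.card_eq_sum_card_fiberwise (f := t) (t := N) (by intro e; simp),
        ← smul_eq_mul, ← Finset.sum_const]
      refine Finset.sum_congr rfl fun a ha => ?_
      rw [← ht a, Finset.filter_filter]
      congr 1
      ext e
      simp only [Finset.mem_filter]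
      grind
    have h₃ : S.filter (s · ∈ X) ⊆ S.filter (t · ∈ N) := by
      intro e he
      simp only [Finset.mem_filter] at he ⊢
      refine ⟨he.1, ?_⟩
      simp only [hN, Finset.mem_biUnion, Finset.mem_image, Finset.mem_filter]
      exact ⟨s e, he.2, e, ⟨he.1, rfl⟩, rfl⟩
    have h₄ := Finset.card_le_card h₃
    rw [h₁, h₂] at h₄
    exact Nat.le_of_mul_le_mul_right h₄ hn
  obtain ⟨f, hf, hmem⟩ := (Finset.all_card_le_biUnion_card_iff_exists_injective _).1 hall
  simp only [Finset.mem_image, Finset.mem_filter] at hmem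
  choose m hm hmf using hmem
  have htm : t ∘ m = f := funext hmf
  exact ⟨m, fun a => (hm a).1, fun a => (hm a).2, htm ▸ Finite.injective_iff_bijective.1 hf⟩

/-- An `n`-regular bipartite multigraph, with edge set `S` and endpoint maps `s` and `t`,
has a proper edge colouring with `n` colours. -/
theorem exists_edge_coloring_of_regular {E A : Type*} [DecidableEq A] [Finite A]
    (s t : E → A) (n : ℕ) (S : Finset E)
    (hs : ∀ a, (S.filter (s · = a)).card = n) (ht : ∀ a, (S.filter (t · = a)).card = n) :
    ∃ c : E → ℕ, (∀ e ∈ S, c e < n) ∧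
      (∀ e ∈ S, ∀ e' ∈ S, s e = s e' → c e = c e' → e = e') ∧
      (∀ e ∈ S, ∀ e' ∈ S, t e = t e' → c e = c e' → e = e') := by
  classical
  induction n generalizing S with
  | zero =>
    have hS : ∀ e, e ∉ S := fun e he => by
      have := Finset.card_eq_zero.1 (hs (s e))
      exact Finset.notMem_empty e (this ▸ Finset.mem_filter.2 ⟨he, rfl⟩)
    exact ⟨fun _ => 0, fun e he => (hS e he).elim, fun e he => (hS e he).elim,
      fun e he => (hS e he).elim⟩
  | succ n ih =>
    obtain ⟨m, hmS, hms, hmt⟩ := exists_perfect_matching_of_regular s t S n.succ_pos hs ht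
    have hinj : ∀ a a', t (m a) = t (m a') → a = a' := fun a a' h => hmt.1 h
    obtain ⟨c, hc, hcs, hct⟩ := ih (S.filter fun e => m (s e) ≠ e)
      (fun a => by
        have : (S.filter fun e => m (s e) ≠ e).filter (s · = a)
            = (S.filter (s · = a)).erase (m a) := by
          ext e
          simp only [Finset.mem_filter, Finset.mem_erase]
          grind
        rw [this, Finset.card_erase_of_mem (Finset.mem_filter.2 ⟨hmS a, hms a⟩), hs]
        rfl)
      (fun b => by
        obtain ⟨a, rfl⟩ := hmt.2 b
        have : (S.filter fun e => m (s e) ≠ e).filter (t · = (t ∘ m) a)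
            = (S.filter (t · = (t ∘ m) a)).erase (m a) := by
          ext e
          simp only [Finset.mem_filter, Finset.mem_erase, Function.comp_apply]
          grind
        rw [this, Finset.card_erase_of_mem (by simp [hmS a]), ht]
        rfl)
    simp only [Finset.mem_filter] at hc hcs hct
    refine ⟨fun e => if m (s e) = e then n else c e, ?_, ?_, ?_⟩
    · intro e he
      have := hc e
      grind
    · intro e he e' he' h h'
      have := hc e
      have := hc e'
      have := hcs e
      grind
    · intro e he e' he' h h'
      have := hc e
      have := hc e'
      have := hct e
      have := hinj (s e) (s e')
      grind

/-- Every permutation of `Fin d_A × Fin d_B` is the composition `π₁ ∘ π₂ ∘ π₃` where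
`π₁, π₃` preserve the first coordinate and `π₂` preserves the second coordinate. -/
theorem perm_prod_decomposition (dA dB : ℕ)
    (π : Equiv.Perm (Fin dA × Fin dB)) :
    ∃ (π₁ π₂ π₃ : Equiv.Perm (Fin dA × Fin dB))
      (f h : Fin dA → Equiv.Perm (Fin dB)) (g : Fin dB → Equiv.Perm (Fin dA)),
      (∀ a b, π₁ (a, b) = (a, f a b)) ∧
      (∀ a b, π₂ (a, b) = (g b a, b)) ∧
      (∀ a b, π₃ (a, b) = (a, h a b)) ∧
      π = π₁ * π₂ * π₃ := by
  have hfst : ∀ a : Fin dA,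
      ((Finset.univ : Finset (Fin dA × Fin dB)).filter (·.1 = a)).card = dB := by
    intro a
    have : (Finset.univ : Finset (Fin dA × Fin dB)).filter (·.1 = a)
        = {a} ×ˢ Finset.univ := by
      ext ⟨x, y⟩
      simp [eq_comm]
    rw [this, Finset.card_product]
    simp
  have hπ : ∀ a : Fin dA,
      ((Finset.univ : Finset (Fin dA × Fin dB)).filter (fun e => (π e).1 = a)).card = dB := by
    intro a
    exact (Finset.card_equiv π (by simp)).trans (hfst a)
  obtain ⟨c, hc, hcs, hct⟩ :=
    exists_edge_coloring_of_regular Prod.fst (fun e => (π e).1) dB Finset.univ hfst hπ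
  simp only [Finset.mem_univ, forall_const] at hc hcs hct
  let h : Fin dA → Equiv.Perm (Fin dB) := fun a =>
    Equiv.ofBijective (fun b => ⟨c (a, b), hc _⟩) <| Finite.injective_iff_bijective.1
      fun b b' hb => (Prod.ext_iff.1 (hcs (a, b) (a, b') rfl (Fin.ext_iff.1 hb))).2
  have hval : ∀ a b, c (a, (h a).symm b) = b := fun a b =>
    Fin.ext_iff.1 ((h a).apply_symm_apply b)
  let g : Fin dB → Equiv.Perm (Fin dA) := fun b =>
    Equiv.ofBijective (fun a => (π (a, (h a).symm b)).1) <| Finite.injective_iff_bijective.1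
      fun a a' ha => (Prod.ext_iff.1 (hct _ _ ha ((hval a b).trans (hval a' b).symm))).1
  have hg : ∀ a b, (π (a, (h a).symm b)).1 = g b a := fun _ _ => rfl
  let f : Fin dA → Equiv.Perm (Fin dB) := fun a =>
    Equiv.ofBijective (fun b => (π ((g b).symm a, (h ((g b).symm a)).symm b)).2) <|
      Finite.injective_iff_bijective.1 fun b b' hb => by
        have key := π.injective (Prod.ext (by simp [hg]) hb)
        have := congrArg c key
        rw [hval, hval] at this
        exact Fin.ext this
  refine ⟨Equiv.prodCongrRight f, Equiv.prodCongrLeft g, Equiv.prodCongrRight h, f, h, g,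
    fun _ _ => rfl, fun _ _ => rfl, fun _ _ => rfl, ?_⟩
  ext1 ⟨a, b⟩
  have hga : g (h a b) a = (π (a, b)).1 := by rw [← hg, Equiv.symm_apply_apply]
  have hfa : f (g (h a b) a) (h a b) = (π (a, b)).2 := by
    simp [f]
  exact Prod.ext hga.symm hfa.symm
end

section
/- Let n ≥ 1 and let d : Fin n → ℕ with d_j ≥ 1 for every j. Every complex permutation matrix U indexed by Π_{j : Fin n} Fin (d j) is the product of at most 2n − 1 complex permutation matrices, each of which is controlled in the computational basis with some single target party t (i.e., each factor G is a complex permutation matrix satisfying G_{x,y} = 0 whenever x_j ≠ y_j for some j ≠ t). Moreover, if U is a permutation matrix, the factors can all be taken to be permutation matrices. -/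
open Matrix BigOperators

/-- A permutation matrix: a 0–1 matrix with exactly one 1 in each row and each column. -/
def IsPermMatrix {n : Type*} (M : Matrix n n ℂ) : Prop :=
  (∀ i j, M i j = 0 ∨ M i j = 1) ∧ (∀ i, ∃! j, M i j = 1) ∧ (∀ j, ∃! i, M i j = 1)

/-- A complex permutation matrix: a unitary with exactly one nonzero entry in each row
and each column. -/
def IsCPermMatrix {n : Type*} [Fintype n] [DecidableEq n] (M : Matrix n n ℂ) : Prop :=
  M ∈ Matrix.unitaryGroup n ℂ ∧ (∀ i, ∃! j, M i j ≠ 0) ∧ (∀ j, ∃! i, M i j ≠ 0)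

/-- An `n`-partite matrix is controlled in the computational basis with target party `t`
if its entry vanishes whenever the row and column indices differ at some party `j ≠ t`. -/
def CtrlTarget {n : ℕ} {d : Fin n → ℕ} (t : Fin n)
    (G : Matrix (∀ j, Fin (d j)) (∀ j, Fin (d j)) ℂ) : Prop :=
  ∀ x y : ∀ j, Fin (d j), (∃ j, j ≠ t ∧ x j ≠ y j) → G x y = 0

/-- A finite set of edges of a bipartite multigraph, with endpoint maps `f` and `g`, that is
regular of positive degree contains a perfect matching. -/
theorem exists_perfect_matching_of_regular_s15 {X L : Type*} [Fintype L]
    [DecidableEq L] (f g : X → L) (E : Finset X) {D : ℕ} (hD : 0 < D)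
    (hf : ∀ l, (E.filter (fun x => f x = l)).card = D)
    (hg : ∀ l, (E.filter (fun x => g x = l)).card = D) :
    ∃ s : L → X, (∀ l, s l ∈ E) ∧ (∀ l, f (s l) = l) ∧
      Function.Bijective (fun l => g (s l)) := by
  let N : L → Finset L := fun l => (E.filter (fun x => f x = l)).image g
  have hcount : ∀ h : X → L, (∀ l, (E.filter (fun x => h x = l)).card = D) →
      ∀ A : Finset L, (E.filter (fun x => h x ∈ A)).card = A.card * D := by
    intro h hh A
    rw [Finset.card_eq_sum_card_fiberwise (f := h) (t := A)
      (fun x hx => Finset.mem_coe.2 (Finset.mem_filter.1 hx).2)]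
    refine Finset.sum_const_nat fun l hl => ?_
    rw [← hh l, Finset.filter_filter]
    congr 1
    ext x
    simp only [Finset.mem_filter]
    exact ⟨fun ⟨h1, _, h2⟩ => ⟨h1, h2⟩, fun ⟨h1, h2⟩ => ⟨h1, h2 ▸ hl, h2⟩⟩
  have hall : ∀ A : Finset L, A.card ≤ (A.biUnion N).card := by
    intro A
    have hsub : E.filter (fun x => f x ∈ A) ⊆ E.filter (fun x => g x ∈ A.biUnion N) := by
      intro x hx
      obtain ⟨hxE, hxA⟩ := Finset.mem_filter.1 hx
      refine Finset.mem_filter.2 ⟨hxE, Finset.mem_biUnion.2 ⟨f x, hxA, ?_⟩⟩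
      exact Finset.mem_image_of_mem g (Finset.mem_filter.2 ⟨hxE, rfl⟩)
    have := Finset.card_le_card hsub
    rw [hcount f hf, hcount g hg] at this
    exact Nat.le_of_mul_le_mul_right this hD
  obtain ⟨φ, hinj, hφ⟩ := (Finset.all_card_le_biUnion_card_iff_exists_injective N).1 hall
  have hs : ∀ l, ∃ x, x ∈ E ∧ f x = l ∧ g x = φ l := by
    intro l
    obtain ⟨x, hx, hgx⟩ := Finset.mem_image.1 (hφ l)
    exact ⟨x, (Finset.mem_filter.1 hx).1, (Finset.mem_filter.1 hx).2, hgx⟩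
  choose s hsE hsf hsg using hs
  refine ⟨s, hsE, hsf, ?_⟩
  have : (fun l => g (s l)) = φ := funext hsg
  rw [this]
  exact Finite.injective_iff_bijective.1 hinj

/-- König's edge colouring theorem for regular bipartite multigraphs. -/
theorem exists_edge_colouring_of_regular {X L : Type*} [DecidableEq X] [Fintype L]
    [DecidableEq L] (f g : X → L) (D : ℕ) (E : Finset X)
    (hf : ∀ l, (E.filter (fun x => f x = l)).card = D)
    (hg : ∀ l, (E.filter (fun x => g x = l)).card = D) :
    ∃ k : X → ℕ, (∀ x ∈ E, k x < D) ∧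
      (∀ x ∈ E, ∀ y ∈ E, k x = k y → f x = f y → x = y) ∧
      (∀ x ∈ E, ∀ y ∈ E, k x = k y → g x = g y → x = y) := by
  induction D generalizing E with
  | zero =>
    have hE : ∀ x, x ∉ E := fun x hx => by
      have h := Finset.card_eq_zero.1 (hf (f x))
      exact Finset.notMem_empty x (h ▸ Finset.mem_filter.2 ⟨hx, rfl⟩)
    exact ⟨fun _ => 0, fun x hx => (hE x hx).elim, fun x hx => (hE x hx).elim,
      fun x hx => (hE x hx).elim⟩
  | succ D ih =>
    obtain ⟨s, hsE, hsf, hsg⟩ := exists_perfect_matching_of_regular_s15 f g E D.succ_pos hf hg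
    let M := Finset.univ.image s
    have hM : ∀ x, x ∈ M ↔ ∃ l, s l = x := fun x => by simp [M]
    have key : ∀ (h : X → L), Function.Bijective (fun l => h (s l)) →
        (∀ l, (E.filter (fun x => h x = l)).card = D + 1) →
        ∀ l, ((E \ M).filter (fun x => h x = l)).card = D := by
      intro h hb hc l
      obtain ⟨l', hl'⟩ := hb.2 l
      have heq : (E \ M).filter (fun x => h x = l) =
          (E.filter (fun x => h x = l)).erase (s l') := by
        ext x
        simp only [Finset.mem_filter, Finset.mem_sdiff, Finset.mem_erase, hM]
        constructor
        · rintro ⟨⟨h1, h2⟩, h3⟩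
          exact ⟨fun h4 => h2 ⟨l', h4.symm⟩, h1, h3⟩
        · rintro ⟨h1, h2, h3⟩
          refine ⟨⟨h2, ?_⟩, h3⟩
          rintro ⟨m, rfl⟩
          exact h1 (congrArg s (hb.1 (h3.trans hl'.symm)))
      rw [heq, Finset.card_erase_of_mem (Finset.mem_filter.2 ⟨hsE l', hl'⟩), hc l]
      rfl
    have hsf' : Function.Bijective (fun l => f (s l)) := by
      simp only [hsf]
      exact Function.bijective_id
    obtain ⟨k, hkD, hkf, hkg⟩ := ih (E \ M) (key f hsf' hf) (key g hsg hg)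
    have glue : ∀ (h : X → L), Function.Bijective (fun l => h (s l)) →
        (∀ x ∈ E \ M, ∀ y ∈ E \ M, k x = k y → h x = h y → x = y) →
        ∀ x ∈ E, ∀ y ∈ E, (if x ∈ M then D else k x) = (if y ∈ M then D else k y) →
          h x = h y → x = y := by
      intro h hb hk x hx y hy hxy hh
      by_cases h1 : x ∈ M <;> by_cases h2 : y ∈ M
      · obtain ⟨l, rfl⟩ := (hM x).1 h1
        obtain ⟨m, rfl⟩ := (hM y).1 h2
        exact congrArg s (hb.1 hh)
      · have := hkD y (Finset.mem_sdiff.2 ⟨hy, h2⟩)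
        simp only [h1, h2, if_true, if_false] at hxy
        omega
      · have := hkD x (Finset.mem_sdiff.2 ⟨hx, h1⟩)
        simp only [h1, h2, if_true, if_false] at hxy
        omega
      · simp only [h1, h2, if_false] at hxy
        exact hk x (Finset.mem_sdiff.2 ⟨hx, h1⟩) y (Finset.mem_sdiff.2 ⟨hy, h2⟩) hxy hh
    refine ⟨fun x => if x ∈ M then D else k x, ?_, glue f hsf' hkf, glue g hsg hkg⟩
    intro x hx
    by_cases h1 : x ∈ M
    · simp [h1]
    · have := hkD x (Finset.mem_sdiff.2 ⟨hx, h1⟩)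
      simp only [h1, if_false]
      omega

/-- A permutation of a product is a product of three permutations, the outer two changing only
the coordinate `t` and the middle one keeping `t` and every other coordinate that is kept by the
given permutation. -/
theorem exists_perm_sandwich {n : ℕ} {d : Fin n → ℕ} (t : Fin n)
    (σ : Equiv.Perm (∀ j, Fin (d j))) :
    ∃ a r b : Equiv.Perm (∀ j, Fin (d j)), σ = a * (r * b) ∧
      (∀ x j, j ≠ t → a x j = x j) ∧ (∀ x j, j ≠ t → b x j = x j) ∧
      (∀ x, r x t = x t) ∧
      ∀ j, (∀ x, σ x j = x j) → ∀ x, r x j = x j := by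
  let rest : (∀ j, Fin (d j)) → (∀ j : {j // j ≠ t}, Fin (d j)) := fun x j => x j
  have hrest : ∀ x y, rest x = rest y ↔ ∀ j, j ≠ t → x j = y j := fun x y =>
    ⟨fun h j hj => congrFun h ⟨j, hj⟩, fun h => funext fun j => h j j.2⟩
  have hcard : ∀ l, (Finset.univ.filter (fun x => rest x = l)).card = d t := by
    intro l
    let e := Equiv.piSplitAt t (fun j => Fin (d j))
    have : (Finset.univ.filter (fun x => rest x = l)) =
        (Finset.univ : Finset (Fin (d t))).map
          ⟨fun i => e.symm (i, l), fun i i' h => (Prod.ext_iff.1 (e.symm.injective h)).1⟩ := by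
      ext x
      simp only [Finset.mem_filter, Finset.mem_univ, true_and, Finset.mem_map]
      constructor
      · rintro rfl
        exact ⟨x t, e.symm_apply_apply x⟩
      · rintro ⟨i, rfl⟩
        exact congrArg Prod.snd (e.apply_symm_apply (i, l))
    rw [this, Finset.card_map, Finset.card_univ, Fintype.card_fin]
  have hcard' : ∀ l, (Finset.univ.filter (fun x => rest (σ x) = l)).card = d t := by
    intro l
    rw [← hcard l]
    exact Finset.card_equiv σ (by simp)
  obtain ⟨k, hk, hk1, hk2⟩ := exists_edge_colouring_of_regular rest (fun x => rest (σ x)) (d t)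
    Finset.univ hcard hcard'
  let c : (∀ j, Fin (d j)) → Fin (d t) := fun x => ⟨k x, hk x (Finset.mem_univ x)⟩
  have hc : ∀ x y, c x = c y → k x = k y := fun x y h => congrArg Fin.val h
  let B : (∀ j, Fin (d j)) → (∀ j, Fin (d j)) := fun x => Function.update x t (c x)
  let R : (∀ j, Fin (d j)) → (∀ j, Fin (d j)) := fun x => Function.update (σ x) t (c x)
  have update_inj : ∀ (x y : ∀ j, Fin (d j)) i i',
      Function.update x t i = Function.update y t i' → i = i' ∧ rest x = rest y := by
    intro x y i i' h
    refine ⟨by simpa using congrFun h t, (hrest x y).2 fun j hj => ?_⟩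
    simpa [hj] using congrFun h j
  have hB : Function.Bijective B := Finite.injective_iff_bijective.1 fun x y h => by
    obtain ⟨h1, h2⟩ := update_inj _ _ _ _ h
    exact hk1 x (Finset.mem_univ x) y (Finset.mem_univ y) (hc x y h1) h2
  have hR : Function.Bijective R := Finite.injective_iff_bijective.1 fun x y h => by
    obtain ⟨h1, h2⟩ := update_inj _ _ _ _ h
    exact hk2 x (Finset.mem_univ x) y (Finset.mem_univ y) (hc x y h1) h2
  let b := Equiv.ofBijective B hB
  let q := Equiv.ofBijective R hR
  have hb : ∀ x, b x = Function.update x t (c x) := fun x => rfl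
  have hq : ∀ x, q x = Function.update (σ x) t (c x) := fun x => rfl
  have hσq : ∀ x, (σ * q⁻¹) (q x) = σ x := fun x => by simp
  have hqb : ∀ x, (q * b⁻¹) (b x) = q x := fun x => by simp
  refine ⟨σ * q⁻¹, q * b⁻¹, b, by group, ?_, ?_, ?_, ?_⟩
  · intro x j hj
    obtain ⟨y, rfl⟩ := q.surjective x
    rw [hσq, hq, Function.update_of_ne hj]
  · intro x j hj
    simp [hb, hj]
  · intro x
    obtain ⟨y, rfl⟩ := b.surjective x
    rw [hqb, hb, hq, Function.update_self, Function.update_self]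
  · intro j h x
    obtain ⟨y, rfl⟩ := b.surjective x
    by_cases hj : j = t
    · subst hj
      rw [hqb, hb, hq, Function.update_self, Function.update_self]
    · rw [hqb, hb, hq, Function.update_of_ne hj, Function.update_of_ne hj, h]

/-- A permutation moving only the coordinates in a nonempty list `t :: ts` is the product of
`2 * ts.length + 1` permutations, each of which moves a single coordinate. -/
theorem exists_perm_factorization {n : ℕ} {d : Fin n → ℕ} (ts : List (Fin n)) (t : Fin n)
    (σ : Equiv.Perm (∀ j, Fin (d j))) (hσ : ∀ j, j ∉ t :: ts → ∀ x, σ x j = x j) :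
    ∃ l : List (Equiv.Perm (∀ j, Fin (d j))), l.length = 2 * ts.length + 1 ∧
      (∀ τ ∈ l, ∃ u, ∀ x j, j ≠ u → τ x j = x j) ∧ σ = l.prod := by
  induction ts generalizing t σ with
  | nil =>
    refine ⟨[σ], rfl, ?_, by simp⟩
    intro τ hτ
    obtain rfl := List.mem_singleton.1 hτ
    exact ⟨t, fun x j hj => hσ j (by simpa using hj) x⟩
  | cons u ts ih =>
    obtain ⟨a, r, b, h, ha, hb, hrt, hr⟩ := exists_perm_sandwich t σ
    obtain ⟨l, hlen, hl, hprod⟩ := ih u r fun j hj => by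
      by_cases hjt : j = t
      · exact hjt ▸ hrt
      · exact hr j (hσ j (by simp_all))
    refine ⟨a :: (l ++ [b]), by simp [hlen]; ring, ?_, by simp [h, hprod]⟩
    intro τ hτ
    simp only [List.mem_cons, List.mem_append, List.not_mem_nil, or_false] at hτ
    rcases hτ with rfl | hτ | rfl
    · exact ⟨t, ha⟩
    · exact hl τ hτ
    · exact ⟨t, hb⟩

/-- The monomial matrix with entry `c (σ y)` at `(σ y, y)`. -/
def monomialMatrix {X : Type*} [DecidableEq X] (c : X → ℂ) (σ : Equiv.Perm X) : Matrix X X ℂ :=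
  Matrix.of fun x y => if x = σ y then c x else 0

theorem monomialMatrix_apply {X : Type*} [DecidableEq X] (c : X → ℂ) (σ : Equiv.Perm X)
    (x y : X) : monomialMatrix c σ x y = if x = σ y then c x else 0 := rfl

theorem monomialMatrix_mul {X : Type*} [Fintype X] [DecidableEq X] (c : X → ℂ)
    (σ τ : Equiv.Perm X) :
    monomialMatrix c σ * monomialMatrix 1 τ = monomialMatrix c (σ * τ) := by
  ext x y
  rw [Matrix.mul_apply, Finset.sum_eq_single (τ y)]
  · rw [monomialMatrix_apply 1, if_pos rfl, Pi.one_apply, mul_one]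
    rfl
  · intro z _ hz
    rw [monomialMatrix_apply 1, if_neg hz, mul_zero]
  · simp

theorem monomialMatrix_list_prod {X : Type*} [Fintype X] [DecidableEq X] (c : X → ℂ)
    (σ : Equiv.Perm X) (l : List (Equiv.Perm X)) :
    monomialMatrix c σ * (l.map (monomialMatrix 1)).prod = monomialMatrix c (σ * l.prod) := by
  induction l generalizing σ with
  | nil => simp
  | cons τ l ih =>
    rw [List.map_cons, List.prod_cons, ← mul_assoc, monomialMatrix_mul, ih, List.prod_cons,
      mul_assoc]

theorem isPermMatrix_monomialMatrix {X : Type*} [DecidableEq X] (σ : Equiv.Perm X) :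
    IsPermMatrix (monomialMatrix 1 σ) := by
  refine ⟨fun x y => ?_, fun x => ⟨σ⁻¹ x, ?_, fun y hy => ?_⟩,
    fun y => ⟨σ y, ?_, fun x hx => ?_⟩⟩
  · by_cases h : x = σ y <;> simp [monomialMatrix_apply, h]
  · simp [monomialMatrix_apply]
  · have : x = σ y := by simpa [monomialMatrix_apply] using hy
    simp [this]
  · simp [monomialMatrix_apply]
  · simpa [monomialMatrix_apply] using hx

theorem isCPermMatrix_monomialMatrix {X : Type*} [Fintype X] [DecidableEq X] (c : X → ℂ)
    (hc : ∀ x, c x * star (c x) = 1) (σ : Equiv.Perm X) :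
    IsCPermMatrix (monomialMatrix c σ) := by
  have hc0 : ∀ x, c x ≠ 0 := fun x h => by simpa [h] using hc x
  refine ⟨?_, fun x => ⟨σ⁻¹ x, ?_, fun y hy => ?_⟩, fun y => ⟨σ y, ?_, fun x hx => ?_⟩⟩
  · rw [Matrix.mem_unitaryGroup_iff']
    ext y z
    have := hc (σ y)
    rw [mul_comm] at this
    by_cases h : y = z
    · subst h
      simpa [Matrix.mul_apply, Matrix.star_apply, monomialMatrix_apply] using this
    · simp [Matrix.mul_apply, Matrix.star_apply, monomialMatrix_apply, h, Ne.symm h]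
  · simp [monomialMatrix_apply, hc0]
  · have : x = σ y := by
      by_contra h
      simp [monomialMatrix_apply, h] at hy
    simp [this]
  · simp [monomialMatrix_apply, hc0]
  · by_contra h
    simp [monomialMatrix_apply, h] at hx

theorem ctrlTarget_monomialMatrix {n : ℕ} {d : Fin n → ℕ} {t : Fin n} (c : (∀ j, Fin (d j)) → ℂ)
    {σ : Equiv.Perm (∀ j, Fin (d j))} (hσ : ∀ x j, j ≠ t → σ x j = x j) :
    CtrlTarget t (monomialMatrix c σ) := by
  rintro x y ⟨j, hj, hxy⟩
  rw [monomialMatrix_apply, if_neg]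
  rintro rfl
  exact hxy (hσ y j hj)

theorem IsCPermMatrix.exists_eq_monomialMatrix {X : Type*} [Fintype X] [DecidableEq X]
    {U : Matrix X X ℂ} (hU : IsCPermMatrix U) :
    ∃ (c : X → ℂ) (σ : Equiv.Perm X), (∀ x, c x * star (c x) = 1) ∧
      U = monomialMatrix c σ := by
  obtain ⟨hun, hrow, hcol⟩ := hU
  choose s hs hs' using hcol
  have hinj : Function.Injective s := fun y z h =>
    (hrow (s y)).unique (hs y) (by rw [h]; exact hs z)
  let σ := Equiv.ofBijective s (Finite.injective_iff_bijective.1 hinj)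
  have hσ : ∀ y, σ y = s y := fun _ => rfl
  have hU : ∀ x y, x ≠ σ y → U x y = 0 := fun x y h => by
    by_contra h'
    exact h (hs' y x h')
  refine ⟨fun x => U x (σ⁻¹ x), σ, fun x => ?_, ?_⟩
  · have h := congrFun (congrFun (Matrix.mem_unitaryGroup_iff.1 hun) x) x
    rw [Matrix.mul_apply, Finset.sum_eq_single (σ⁻¹ x)] at h
    · simpa [Matrix.star_apply] using h
    · intro y _ hy
      rw [hU x y (fun e => hy (by simp [e])), zero_mul]
    · simp
  · ext x y
    rw [monomialMatrix_apply]
    split_ifs with h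
    · simp [h]
    · exact hU x y h

theorem eq_one_of_isPermMatrix_monomialMatrix {X : Type*} [DecidableEq X] {c : X → ℂ}
    {σ : Equiv.Perm X} (h : IsPermMatrix (monomialMatrix c σ)) : c = 1 := by
  funext x
  obtain ⟨y, hy, -⟩ := h.2.1 x
  rw [monomialMatrix_apply] at hy
  split_ifs at hy with hx
  · exact hy
  · exact (zero_ne_one hy).elim

/-- Every `n`-partite complex permutation matrix is the product of at most `2n − 1`
complex permutation matrices each controlled with a single target party; if it is a
permutation matrix, the factors can be taken to be permutation matrices. -/
theorem multipartite_cperm_sandwich (n : ℕ) (hn : 1 ≤ n) (d : Fin n → ℕ)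
    (hd : ∀ j, 1 ≤ d j)
    (U : Matrix (∀ j, Fin (d j)) (∀ j, Fin (d j)) ℂ) (hU : IsCPermMatrix U) :
    (∃ m : ℕ, m ≤ 2 * n - 1 ∧
      ∃ f : Fin m → Matrix (∀ j, Fin (d j)) (∀ j, Fin (d j)) ℂ,
        (∀ i, IsCPermMatrix (f i)) ∧
        (∀ i, ∃ t : Fin n, CtrlTarget t (f i)) ∧
        U = (List.ofFn f).prod) ∧
    (IsPermMatrix U →
      ∃ m : ℕ, m ≤ 2 * n - 1 ∧
        ∃ f : Fin m → Matrix (∀ j, Fin (d j)) (∀ j, Fin (d j)) ℂ,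
          (∀ i, IsPermMatrix (f i)) ∧
          (∀ i, ∃ t : Fin n, CtrlTarget t (f i)) ∧
          U = (List.ofFn f).prod) := by
  obtain ⟨c, σ, hc, rfl⟩ := hU.exists_eq_monomialMatrix
  obtain ⟨k, rfl⟩ : ∃ k, n = k + 1 := ⟨n - 1, by omega⟩
  obtain ⟨l, hlen, hl, rfl⟩ := exists_perm_factorization
    (List.ofFn fun i : Fin k => i.succ) 0 σ fun j hj => (hj (by
      rw [List.mem_cons, List.mem_ofFn]
      exact (Fin.eq_zero_or_eq_succ j).imp_right fun ⟨i, hi⟩ => ⟨i, hi.symm⟩)).elim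
  rw [List.length_ofFn] at hlen
  obtain ⟨τ, l, rfl⟩ := List.exists_cons_of_length_eq_add_one hlen
  rw [List.length_cons] at hlen
  let L := monomialMatrix c τ :: l.map (monomialMatrix 1)
  have hL : monomialMatrix c (τ :: l).prod = (List.ofFn L.get).prod := by
    rw [List.ofFn_get, List.prod_cons, List.prod_cons, monomialMatrix_list_prod]
  have hlenL : L.length ≤ 2 * (k + 1) - 1 := by
    simp only [L, List.length_cons, List.length_map]
    omega
  have hmem : ∀ G ∈ L, ∃ ρ ∈ τ :: l, G = monomialMatrix c ρ ∨ G = monomialMatrix 1 ρ := by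
    intro G hG
    rcases List.mem_cons.1 hG with rfl | hG
    · exact ⟨τ, List.mem_cons_self, Or.inl rfl⟩
    · obtain ⟨ρ, hρ, rfl⟩ := List.mem_map.1 hG
      exact ⟨ρ, List.mem_cons_of_mem _ hρ, Or.inr rfl⟩
  have hctrl : ∀ i, ∃ t, CtrlTarget t (L.get i) := by
    intro i
    obtain ⟨ρ, hρ, h⟩ := hmem _ (L.get_mem i)
    obtain ⟨t, ht⟩ := hl ρ hρ
    refine ⟨t, ?_⟩
    rcases h with h | h <;> rw [h] <;> exact ctrlTarget_monomialMatrix _ ht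
  refine ⟨⟨L.length, hlenL, L.get, fun i => ?_, hctrl, hL⟩,
    fun hP => ⟨L.length, hlenL, L.get, fun i => ?_, hctrl, hL⟩⟩
  · obtain ⟨ρ, -, h | h⟩ := hmem _ (L.get_mem i) <;> rw [h]
    · exact isCPermMatrix_monomialMatrix c hc ρ
    · exact isCPermMatrix_monomialMatrix 1 (by simp) ρ
  · have hc1 : c = 1 := eq_one_of_isPermMatrix_monomialMatrix hP
    obtain ⟨ρ, -, h | h⟩ := hmem _ (L.get_mem i) <;> rw [h]
    · exact hc1 ▸ isPermMatrix_monomialMatrix ρ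
    · exact isPermMatrix_monomialMatrix ρ
end
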